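/- For every natural number n ≥ 1 and all elements q_0, q_1, ..., q_n and c of a commutative ring (e.g., all real numbers), the following identity holds: Σ_{F ∈ F_n} q_0^{lead_0(F)} q_1^{lead_1(F)} ··· q_n^{lead_n(F)} c^{tree(F)} = Σ_{P ∈ PF_n} q_0^{lucky_0(P)} q_1^{lucky_1(P)} ··· q_n^{lucky_n(P)} c^{critic(P)}, where lead_i(F) is the number of vertices v of F with inv(F:v) = i and lucky_i(P) is the number of cars c with jump(P:c) = i. -/

import Mathlib

/-!  Parking functions and the parking algorithm. -/

/-- Parking algorithm: cars `0, 1, ..., n-1` (in Lean's 0-based indexing of `Fin n`,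
representing cars `1, ..., n`) arrive in order; car `i` drives to its favorite
(1-indexed) space `p i` and parks in the first space `s ≥ p i` not occupied by an
earlier car.  `PA p i` is the space where car `i` actually parks. -/
noncomputable def PA {n : ℕ} (p : Fin n → ℕ) (i : Fin n) : ℕ :=
  sInf {s : ℕ | p i ≤ s ∧ ∀ j : Fin n, j < i → PA p j ≠ s}
termination_by i.val
decreasing_by exact ‹_ < _›

/-- `p` is a parking function of length `n`: every favorite space is in `{1, ..., n}`
and every car ends up parked in a space `≤ n`. -/
def IsParkingFunction {n : ℕ} (p : Fin n → ℕ) : Prop :=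
  (∀ i, 1 ≤ p i ∧ p i ≤ n) ∧ ∀ i, PA p i ≤ n

/-- The set (type) `PF_n` of parking functions of length `n`. -/
def ParkingFunction (n : ℕ) : Type :=
  {p : Fin n → ℕ // IsParkingFunction p}

instance {n : ℕ} : Finite (ParkingFunction n) := by
  apply Finite.of_injective
    (fun P : ParkingFunction n => fun i => (⟨P.1 i, Nat.lt_succ_of_le (P.2.1 i).2⟩ : Fin (n+1)))
  intro P Q h
  apply Subtype.ext; funext i
  simpa [Fin.mk.injEq] using congrFun h i

noncomputable instance {n : ℕ} : Fintype (ParkingFunction n) := Fintype.ofFinite _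

/-- `jumpAt p c` is the number of jumps of car `c`, i.e. `q_c - p_c`. -/
noncomputable def jumpAt {n : ℕ} (p : Fin n → ℕ) (c : Fin n) : ℕ := PA p c - p c

/-- `jump p` is the total number of jumps. -/
noncomputable def jump {n : ℕ} (p : Fin n → ℕ) : ℕ := ∑ c, jumpAt p c

/-- `luckyCount p k` is the number of cars `c` with `jump(p : c) = k`. -/
noncomputable def luckyCount {n : ℕ} (p : Fin n → ℕ) (k : ℕ) : ℕ :=
  Set.ncard {c : Fin n | jumpAt p c = k}

/-- `lucky p` is the number of lucky cars, i.e. cars with no jumps. -/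
noncomputable def lucky {n : ℕ} (p : Fin n → ℕ) : ℕ :=
  Set.ncard {c : Fin n | jumpAt p c = 0}

/-- Car `c` is critical: immediately after car `c` is parked, there is no empty space
among the spaces strictly to the right of its space `q_c` within `{1, ..., n}`. -/
def IsCritical {n : ℕ} (p : Fin n → ℕ) (c : Fin n) : Prop :=
  ∀ s : ℕ, PA p c < s → s ≤ n → ∃ j : Fin n, j ≤ c ∧ PA p j = s

/-- `critic p` is the number of critical cars. -/
noncomputable def critic {n : ℕ} (p : Fin n → ℕ) : ℕ :=
  Set.ncard {c : Fin n | IsCritical p c}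

/-!  Rooted labeled forests, encoded by their parent function. -/

/-- A parent function `par : Fin n → Option (Fin n)` (where `par v = none` means that
`v` is a root) encodes a rooted labeled forest on `n` vertices iff it has no cycles. -/
def IsForest {n : ℕ} (par : Fin n → Option (Fin n)) : Prop :=
  ∀ v : Fin n, ¬ Relation.TransGen (fun a b => par a = some b) v v

/-- The set (type) `F_n` of rooted labeled forests on `n` vertices. -/
def Forest (n : ℕ) : Type := {par : Fin n → Option (Fin n) // IsForest par}

instance {n : ℕ} : Finite (Forest n) := Subtype.finite
noncomputable instance {n : ℕ} : Fintype (Forest n) := Fintype.ofFinite _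

/-- `x` is a descendant of `v`: `v` lies on the (unique) path from the root of `x`'s
component to `x`, i.e. the ancestor chain of `x` reaches `v`. -/
def Descendant {n : ℕ} (par : Fin n → Option (Fin n)) (v x : Fin n) : Prop :=
  Relation.ReflTransGen (fun a b => par a = some b) x v

/-- `forestInvAt F v = inv(F : v)`, the number of pairs `(v, x)` with `v > x` and
`x` a descendant of `v`. -/
noncomputable def forestInvAt {n : ℕ} (F : Forest n) (v : Fin n) : ℕ :=
  Set.ncard {x : Fin n | x < v ∧ Descendant F.1 v x}

/-- `forestInv F = inv(F)`, the total number of inversions of `F`. -/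
noncomputable def forestInv {n : ℕ} (F : Forest n) : ℕ := ∑ v, forestInvAt F v

/-- `forestLeadCount F k` is the number of vertices `v` with `inv(F : v) = k`. -/
noncomputable def forestLeadCount {n : ℕ} (F : Forest n) (k : ℕ) : ℕ :=
  Set.ncard {v : Fin n | forestInvAt F v = k}

/-- `forestLead F = lead(F)`, the number of leaders of `F`. -/
noncomputable def forestLead {n : ℕ} (F : Forest n) : ℕ :=
  Set.ncard {v : Fin n | forestInvAt F v = 0}

/-- `forestTree F = tree(F)`, the number of trees (connected components) of `F`,
i.e. the number of roots. -/
noncomputable def forestTree {n : ℕ} (F : Forest n) : ℕ :=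
  Set.ncard {v : Fin n | F.1 v = none}

open Finset

/-- The common value of the two generating functions, given by their shared recurrence. -/
noncomputable def forestParkingPoly {R : Type*} [CommRing R] (q : ℕ → R) (c : R) : ℕ → R
  | 0 => 1
  | n + 1 => ∑ k : Fin (n + 1), n.choose k •
      (c * (∑ j ∈ range (k + 1), q j) * forestParkingPoly q 1 k * forestParkingPoly q c (n - k))
termination_by n => n

theorem forestParkingPoly_succ {R : Type*} [CommRing R] (q : ℕ → R) (c : R) {ι : Type*}
    (s : Finset ι) :
    forestParkingPoly q c (#s + 1) = ∑ A ∈ s.powerset,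
      c * (∑ j ∈ range (#A + 1), q j) * forestParkingPoly q 1 #A *
        forestParkingPoly q c (#s - #A) := by
  rw [forestParkingPoly, sum_powerset_apply_card (fun k =>
    c * (∑ j ∈ range (k + 1), q j) * forestParkingPoly q 1 k * forestParkingPoly q c (#s - k)),
    Finset.sum_range]

/-- Collecting equal factors of a product according to the value of a statistic. -/
theorem prod_range_pow_ncard {R ι : Type*} [CommMonoid R] [Fintype ι] (q : ℕ → R) (f : ι → ℕ)
    (N : ℕ) (hf : ∀ i, f i < N) :
    ∏ k ∈ range N, q k ^ Set.ncard {i | f i = k} = ∏ i, q (f i) := by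
  classical
  rw [← prod_fiberwise_of_maps_to (s := univ) (t := range N) (g := f) (by simpa using hf)]
  refine prod_congr rfl fun k _ => ?_
  rw [prod_congr rfl (g := fun _ => q k) (by simp +contextual), prod_const,
    Set.ncard_eq_toFinset_card']
  simp

open Classical in
/-- A power counting the elements with a property is a product of indicator factors. -/
theorem pow_ncard_eq_prod_ite {R ι : Type*} [CommMonoid R] [Fintype ι] (c : R) (p : ι → Prop) :
    c ^ Set.ncard {i | p i} = ∏ i, if p i then c else 1 := by
  rw [prod_ite, prod_const, prod_const_one, mul_one, Set.ncard_eq_toFinset_card']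
  simp

section GlueOutcome

variable {ι : Type*} [LinearOrder ι] {s A : Finset ι} {m : ι} {σ τ : ι → ℕ}

/-- Combine outcomes of the cars to the left and to the right of the last car `m`. -/
def glueOutcome (m : ι) (A : Finset ι) (k : ℕ) (σ τ : ι → ℕ) (i : ι) : ℕ :=
  if i = m then k else if i ∈ A then σ i else τ i

theorem glueOutcome_last (k : ℕ) : glueOutcome m A k σ τ m = k := by simp [glueOutcome]

theorem glueOutcome_left (k : ℕ) (hA : A ⊆ s.erase m) {i : ι} (hi : i ∈ A) :
    glueOutcome m A k σ τ i = σ i := by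
  have := ne_of_mem_erase (hA hi)
  simp [glueOutcome, hi, this]

theorem glueOutcome_right (k : ℕ) {i : ι} (hi : i ∈ s.erase m \ A) :
    glueOutcome m A k σ τ i = τ i := by
  simp only [mem_sdiff, mem_erase] at hi
  simp [glueOutcome, hi]

theorem eq_or_mem_or_mem_sdiff (A : Finset ι) {i : ι} (hi : i ∈ s) :
    i = m ∨ i ∈ A ∨ i ∈ s.erase m \ A := by
  simp only [mem_sdiff, mem_erase]; tauto

theorem card_split (hm : m ∈ s) (hA : A ⊆ s.erase m) :
    #(s.erase m \ A) + #A + 1 = #s := by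
  rw [card_sdiff_add_card_eq_card hA, card_erase_add_one hm]

theorem prod_eq_mul_split {M : Type*} [CommMonoid M] (hm : m ∈ s) (hA : A ⊆ s.erase m)
    (f : ι → M) :
    ∏ i ∈ s, f i = f m * ((∏ i ∈ A, f i) * ∏ i ∈ s.erase m \ A, f i) := by
  rw [← mul_prod_erase s f hm, ← prod_sdiff hA, mul_comm (∏ i ∈ A, f i)]

end GlueOutcome

section Parking

variable {ι : Type*} [Fintype ι] [LinearOrder ι]

open Classical in
/-- Outcomes of parking the cars in `s` on the spaces `b + 1, ..., b + #s`, extended by `0`. -/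
noncomputable def outcomes (s : Finset ι) (b : ℕ) : Finset (ι → ℕ) :=
  {σ ∈ Fintype.piFinset (fun i => if i ∈ s then Ioc b (b + #s) else {0}) | Set.InjOn σ s}

theorem mem_outcomes {s : Finset ι} {b : ℕ} {σ : ι → ℕ} :
    σ ∈ outcomes s b ↔ (∀ i ∈ s, b < σ i ∧ σ i ≤ b + #s) ∧ (∀ i ∉ s, σ i = 0) ∧
      Set.InjOn σ s := by
  simp only [outcomes, mem_filter, Fintype.mem_piFinset, ← and_assoc]
  refine and_congr_left fun _ => ⟨fun h => ⟨fun i hi => ?_, fun i hi => ?_⟩, fun h i => ?_⟩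
  · simpa [hi] using h i
  · simpa [hi] using h i
  · by_cases hi : i ∈ s
    · simpa [hi] using h.1 i hi
    · simpa [hi] using h.2 i hi

theorem image_of_mem_outcomes {s : Finset ι} {b : ℕ} {σ : ι → ℕ} (h : σ ∈ outcomes s b) :
    s.image σ = Ioc b (b + #s) := by
  obtain ⟨h1, -, h3⟩ := mem_outcomes.1 h
  apply eq_of_subset_of_card_le
  · intro t ht
    obtain ⟨i, hi, rfl⟩ := mem_image.1 ht
    exact mem_Ioc.2 (h1 i hi)
  · rw [card_image_of_injOn h3]; simp

theorem exists_of_mem_outcomes {s : Finset ι} {b : ℕ} {σ : ι → ℕ} (h : σ ∈ outcomes s b)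
    {t : ℕ} (h1 : b < t) (h2 : t ≤ b + #s) : ∃ i ∈ s, σ i = t := by
  have : t ∈ s.image σ := by rw [image_of_mem_outcomes h]; exact mem_Ioc.2 ⟨h1, h2⟩
  simpa using this

open Classical in
/-- The preferences of car `i` that lead to it parking in space `σ i`. -/
noncomputable def preferences (s : Finset ι) (b : ℕ) (σ : ι → ℕ) (i : ι) : Finset ℕ :=
  {t ∈ Ioc b (σ i) | ∀ u, t ≤ u → u < σ i → ∃ j ∈ s, j < i ∧ σ j = u}

/-- Car `i` is critical for the outcome `σ`. -/
def OutcomeCritical (s : Finset ι) (b : ℕ) (σ : ι → ℕ) (i : ι) : Prop :=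
  ∀ u, σ i < u → u ≤ b + #s → ∃ j ∈ s, j ≤ i ∧ σ j = u

variable {R : Type*} [CommRing R]

open Classical in
/-- The total weight of the possible preferences of car `i`. -/
noncomputable def carWeight (q : ℕ → R) (c : R) (s : Finset ι) (b : ℕ) (σ : ι → ℕ) (i : ι) : R :=
  (∑ t ∈ preferences s b σ i, q (σ i - t)) * if OutcomeCritical s b σ i then c else 1

/-- The generating function of the parking functions of the cars in `s`. -/
noncomputable def parkingSum (q : ℕ → R) (c : R) (s : Finset ι) (b : ℕ) : R :=
  ∑ σ ∈ outcomes s b, ∏ i ∈ s, carWeight q c s b σ i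

section Glue

variable {s A : Finset ι} {m : ι} {b : ℕ} {σ τ : ι → ℕ}

theorem glueOutcome_mem (hm : m ∈ s) (hA : A ⊆ s.erase m) (hσ : σ ∈ outcomes A b)
    (hτ : τ ∈ outcomes (s.erase m \ A) (b + #A + 1)) :
    glueOutcome m A (b + #A + 1) σ τ ∈ outcomes s b := by
  have hc := card_split hm hA
  obtain ⟨a1, a2, a3⟩ := mem_outcomes.1 hσ
  obtain ⟨b1, b2, b3⟩ := mem_outcomes.1 hτ
  refine mem_outcomes.2 ⟨fun i hi => ?_, fun i hi => ?_, fun i hi j hj hij => ?_⟩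
  · rcases eq_or_mem_or_mem_sdiff (m := m) A hi with rfl | h | h
    · rw [glueOutcome_last]; omega
    · rw [glueOutcome_left _ hA h]; have := a1 i h; omega
    · rw [glueOutcome_right _ h]; have := b1 i h; omega
  · have h1 : i ≠ m := by rintro rfl; exact hi hm
    have h2 : i ∉ A := fun h => hi (mem_of_mem_erase (hA h))
    simp only [glueOutcome, h1, h2, if_false]
    exact b2 i (by simp [hi])
  · have hval : ∀ i ∈ s, (i = m ∧ glueOutcome m A (b + #A + 1) σ τ i = b + #A + 1) ∨
        (i ∈ A ∧ glueOutcome m A (b + #A + 1) σ τ i = σ i) ∨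
        (i ∈ s.erase m \ A ∧ glueOutcome m A (b + #A + 1) σ τ i = τ i) := by
      intro i hi
      rcases eq_or_mem_or_mem_sdiff (m := m) A hi with h | h | h
      · exact .inl ⟨h, by rw [h, glueOutcome_last]⟩
      · exact .inr (.inl ⟨h, glueOutcome_left _ hA h⟩)
      · exact .inr (.inr ⟨h, glueOutcome_right _ h⟩)
    rcases hval i hi with ⟨h, hv⟩ | ⟨h, hv⟩ | ⟨h, hv⟩ <;>
    rcases hval j hj with ⟨h', hv'⟩ | ⟨h', hv'⟩ | ⟨h', hv'⟩ <;>
    rw [hv, hv'] at hij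
    · exact h.trans h'.symm
    · have := a1 j h'; omega
    · have := b1 j h'; omega
    · have := a1 i h; omega
    · exact a3 h h' hij
    · have := a1 i h; have := b1 j h'; omega
    · have := b1 i h; omega
    · have := b1 i h; have := a1 j h'; omega
    · exact b3 h h' hij

theorem glueOutcome_filter (hm : m ∈ s) (hA : A ⊆ s.erase m) (hσ : σ ∈ outcomes A b)
    (hτ : τ ∈ outcomes (s.erase m \ A) (b + #A + 1)) :
    {i ∈ s | glueOutcome m A (b + #A + 1) σ τ i < glueOutcome m A (b + #A + 1) σ τ m} = A := by
  obtain ⟨a1, a2, a3⟩ := mem_outcomes.1 hσ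
  obtain ⟨b1, b2, b3⟩ := mem_outcomes.1 hτ
  ext i
  rw [mem_filter, glueOutcome_last]
  constructor
  · rintro ⟨hi, hlt⟩
    rcases eq_or_mem_or_mem_sdiff (m := m) A hi with rfl | h | h
    · rw [glueOutcome_last] at hlt; omega
    · exact h
    · rw [glueOutcome_right _ h] at hlt; have := b1 i h; omega
  · intro h
    refine ⟨mem_of_mem_erase (hA h), ?_⟩
    rw [glueOutcome_left _ hA h]; have := a1 i h; omega

theorem carWeight_glueOutcome_last (q : ℕ → R) (c : R) (hm : m ∈ s) (hmax : ∀ i ∈ s, i ≤ m)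
    (hA : A ⊆ s.erase m) (hσ : σ ∈ outcomes A b)
    (hτ : τ ∈ outcomes (s.erase m \ A) (b + #A + 1)) :
    carWeight q c s b (glueOutcome m A (b + #A + 1) σ τ) m =
      c * ∑ j ∈ range (#A + 1), q j := by
  have hg := glueOutcome_mem hm hA hσ hτ
  have hc := card_split hm hA
  set ρ := glueOutcome m A (b + #A + 1) σ τ with hρ
  have hρm : ρ m = b + #A + 1 := glueOutcome_last _
  have hcrit : OutcomeCritical s b ρ m := fun u h1 h2 => by
    obtain ⟨j, hj, rfl⟩ := exists_of_mem_outcomes hg (t := u) (by omega) h2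
    exact ⟨j, hj, hmax j hj, rfl⟩
  have hpref : preferences s b ρ m = Ioc b (b + #A + 1) := by
    rw [preferences, hρm]
    refine filter_true_of_mem fun t ht u h1 h2 => ?_
    rw [mem_Ioc] at ht
    obtain ⟨j, hj, rfl⟩ := exists_of_mem_outcomes hg (t := u) (by omega) (by omega)
    exact ⟨j, hj, lt_of_le_of_ne (hmax j hj) (by rintro rfl; omega), rfl⟩
  rw [carWeight, if_pos hcrit, hpref, hρm, mul_comm]
  congr 1
  refine sum_bij' (fun t _ => b + #A + 1 - t) (fun j _ => b + #A + 1 - j) ?_ ?_ ?_ ?_ ?_ <;>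
    simp only [mem_Ioc, mem_range, implies_true] <;> intros <;> omega

theorem carWeight_glueOutcome_left (q : ℕ → R) (c : R) (hm : m ∈ s) (hmax : ∀ i ∈ s, i ≤ m)
    (hA : A ⊆ s.erase m) (hσ : σ ∈ outcomes A b)
    (hτ : τ ∈ outcomes (s.erase m \ A) (b + #A + 1)) {i : ι} (hi : i ∈ A) :
    carWeight q c s b (glueOutcome m A (b + #A + 1) σ τ) i = carWeight q 1 A b σ i := by
  have hg := glueOutcome_mem hm hA hσ hτ
  have hc := card_split hm hA
  obtain ⟨a1, a2, a3⟩ := mem_outcomes.1 hσ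
  obtain ⟨b1, b2, b3⟩ := mem_outcomes.1 hτ
  obtain ⟨g1, g2, g3⟩ := mem_outcomes.1 hg
  have hl := fun j hj => glueOutcome_left (s := s) (σ := σ) (τ := τ) (b + #A + 1) hA (i := j) hj
  have hr := fun j hj => glueOutcome_right (s := s) (A := A) (m := m) (σ := σ) (τ := τ)
    (b + #A + 1) (i := j) hj
  have hρm : glueOutcome m A (b + #A + 1) σ τ m = b + #A + 1 := glueOutcome_last _
  set ρ := glueOutcome m A (b + #A + 1) σ τ with hρ
  have hsA : i ∈ s.erase m := hA hi
  have hcrit : ¬ OutcomeCritical s b ρ i := fun h => by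
    have := a1 i hi
    obtain ⟨j, hj, hji, hju⟩ := h (b + #A + 1) (by rw [hl i hi]; omega) (by omega)
    have : j = m := g3 hj hm (by rw [hju, hρm])
    subst this
    exact (ne_of_mem_erase hsA) (le_antisymm (hmax i (mem_of_mem_erase hsA)) hji)
  have hpref : preferences s b ρ i = preferences A b σ i := by
    rw [preferences, preferences, hl i hi]
    refine filter_congr fun t ht => forall_congr' fun u => forall_congr' fun h1 =>
      forall_congr' fun h2 => ⟨?_, ?_⟩
    · rintro ⟨j, hj, hji, rfl⟩
      have := a1 i hi
      rcases eq_or_mem_or_mem_sdiff (m := m) A hj with rfl | h | h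
      · omega
      · exact ⟨j, h, hji, (hl j h).symm⟩
      · rw [hr j h] at h2; have := b1 j h; omega
    · rintro ⟨j, hj, hji, rfl⟩
      exact ⟨j, mem_of_mem_erase (hA hj), hji, hl j hj⟩
  rw [carWeight, carWeight, if_neg hcrit, hpref, ite_self, hl i hi]

theorem carWeight_glueOutcome_right (q : ℕ → R) (c : R) (hm : m ∈ s) (hmax : ∀ i ∈ s, i ≤ m)
    (hA : A ⊆ s.erase m) (hσ : σ ∈ outcomes A b)
    (hτ : τ ∈ outcomes (s.erase m \ A) (b + #A + 1)) {i : ι} (hi : i ∈ s.erase m \ A) :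
    carWeight q c s b (glueOutcome m A (b + #A + 1) σ τ) i =
      carWeight q c (s.erase m \ A) (b + #A + 1) τ i := by
  have hg := glueOutcome_mem hm hA hσ hτ
  have hc := card_split hm hA
  obtain ⟨a1, a2, a3⟩ := mem_outcomes.1 hσ
  obtain ⟨b1, b2, b3⟩ := mem_outcomes.1 hτ
  obtain ⟨g1, g2, g3⟩ := mem_outcomes.1 hg
  have hl := fun j hj => glueOutcome_left (s := s) (σ := σ) (τ := τ) (b + #A + 1) hA (i := j) hj
  have hr := fun j hj => glueOutcome_right (s := s) (A := A) (m := m) (σ := σ) (τ := τ)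
    (b + #A + 1) (i := j) hj
  have hρm : glueOutcome m A (b + #A + 1) σ τ m = b + #A + 1 := glueOutcome_last _
  set ρ := glueOutcome m A (b + #A + 1) σ τ with hρ
  have hsB : i ∈ s.erase m := (mem_sdiff.1 hi).1
  have hBs : ∀ j ∈ s.erase m \ A, j ∈ s := fun j hj => mem_of_mem_erase (mem_sdiff.1 hj).1
  have hi' := b1 i hi
  have key : ∀ (u : ℕ), b + #A + 1 < u → ∀ j ∈ s, ρ j = u → j ∈ s.erase m \ A ∧ τ j = u := by
    rintro u hu j hj rfl
    rcases eq_or_mem_or_mem_sdiff (m := m) A hj with rfl | h | h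
    · omega
    · rw [hl j h] at hu; have := a1 j h; omega
    · exact ⟨h, (hr j h).symm⟩
  have hcrit : OutcomeCritical s b ρ i ↔ OutcomeCritical (s.erase m \ A) (b + #A + 1) τ i := by
    unfold OutcomeCritical
    rw [hr i hi, show b + #A + 1 + #(s.erase m \ A) = b + #s by omega]
    refine forall_congr' fun u => forall_congr' fun h1 => forall_congr' fun h2 => ⟨?_, ?_⟩
    · rintro ⟨j, hj, hji, hju⟩
      obtain ⟨h, h'⟩ := key u (by omega) j hj hju
      exact ⟨j, h, hji, h'⟩
    · rintro ⟨j, hj, hji, rfl⟩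
      exact ⟨j, hBs j hj, hji, hr j hj⟩
  have hpref : preferences s b ρ i = preferences (s.erase m \ A) (b + #A + 1) τ i := by
    ext t
    simp only [preferences, mem_filter, mem_Ioc, hr i hi]
    constructor
    · rintro ⟨⟨h1, h2⟩, h3⟩
      have ht : b + #A + 1 < t := by
        by_contra hcon
        obtain ⟨j, hj, hji, hju⟩ := h3 (b + #A + 1) (by omega) (by omega)
        have : j = m := g3 hj hm (by rw [hju, hρm])
        subst this
        exact absurd (hmax i (hBs i hi)) (not_le.2 hji)
      refine ⟨⟨ht, h2⟩, fun u hu1 hu2 => ?_⟩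
      obtain ⟨j, hj, hji, hju⟩ := h3 u hu1 hu2
      obtain ⟨h, h'⟩ := key u (by omega) j hj hju
      exact ⟨j, h, hji, h'⟩
    · rintro ⟨⟨h1, h2⟩, h3⟩
      refine ⟨⟨by omega, h2⟩, fun u hu1 hu2 => ?_⟩
      obtain ⟨j, hj, hji, rfl⟩ := h3 u hu1 hu2
      exact ⟨j, hBs j hj, hji, hr j hj⟩
  classical
  rw [carWeight, carWeight, hpref, hr i hi]
  congr 1
  exact if_congr hcrit rfl rfl

theorem apply_last_of_filter_eq {ρ : ι → ℕ} (hm : m ∈ s) (hρ : ρ ∈ outcomes s b)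
    (hρA : {i ∈ s | ρ i < ρ m} = A) : ρ m = b + #A + 1 := by
  obtain ⟨g1, g2, g3⟩ := mem_outcomes.1 hρ
  have hA' : ∀ i, i ∈ A ↔ i ∈ s ∧ ρ i < ρ m := fun i => by rw [← hρA, mem_filter]
  have hlast := g1 m hm
  have him : A.image ρ = Ioc b (ρ m - 1) := by
    ext t
    rw [mem_image, mem_Ioc]
    constructor
    · rintro ⟨i, hi, rfl⟩
      have := (hA' i).1 hi
      have := g1 i this.1
      omega
    · rintro ⟨h1, h2⟩
      obtain ⟨j, hj, rfl⟩ := exists_of_mem_outcomes hρ (t := t) h1 (by omega)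
      exact ⟨j, (hA' j).2 ⟨hj, by omega⟩, rfl⟩
  have := congrArg card him
  rw [card_image_of_injOn (g3.mono fun i hi => ((hA' i).1 hi).1), Nat.card_Ioc] at this
  omega

theorem parkingSum_fiber (q : ℕ → R) (c : R) (hm : m ∈ s) (hmax : ∀ i ∈ s, i ≤ m)
    (hA : A ⊆ s.erase m) :
    ∑ σ ∈ outcomes s b with {i ∈ s | σ i < σ m} = A, ∏ i ∈ s, carWeight q c s b σ i =
      c * (∑ j ∈ range (#A + 1), q j) * parkingSum q 1 A b *
        parkingSum q c (s.erase m \ A) (b + #A + 1) := by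
  rw [mul_assoc, parkingSum, parkingSum, sum_mul_sum, ← sum_product', mul_sum]
  symm
  refine sum_bij' (fun x _ => glueOutcome m A (b + #A + 1) x.1 x.2)
    (fun ρ _ => (fun i => if i ∈ A then ρ i else 0,
      fun i => if i ∈ s.erase m \ A then ρ i else 0)) ?_ ?_ ?_ ?_ ?_
  · rintro ⟨σ, τ⟩ h
    obtain ⟨hσ, hτ⟩ := mem_product.1 h
    exact mem_filter.2 ⟨glueOutcome_mem hm hA hσ hτ, glueOutcome_filter hm hA hσ hτ⟩
  · intro ρ h
    obtain ⟨hρ, hρA⟩ := mem_filter.1 h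
    have hc := card_split hm hA
    obtain ⟨g1, g2, g3⟩ := mem_outcomes.1 hρ
    have hA' : ∀ i, i ∈ A ↔ i ∈ s ∧ ρ i < ρ m := fun i => by rw [← hρA, mem_filter]
    have hBs : ∀ j ∈ s.erase m \ A, j ∈ s := fun j hj => mem_of_mem_erase (mem_sdiff.1 hj).1
    have hρm := apply_last_of_filter_eq hm hρ hρA
    refine mem_product.2 ⟨mem_outcomes.2 ⟨fun i hi => ?_, fun i hi => if_neg hi, ?_⟩,
      mem_outcomes.2 ⟨fun i hi => ?_, fun i hi => if_neg hi, ?_⟩⟩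
    · have := (hA' i).1 hi
      have := g1 i this.1
      simp only [hi, if_true]; omega
    · refine (g3.mono fun i hi => ((hA' i).1 hi).1).congr fun i hi => ?_
      exact (if_pos hi).symm
    · have h1 := g1 i (hBs i hi)
      have h2 := hA' i
      have h3 := hBs i hi
      have h4 : ρ i ≠ ρ m := fun h => (ne_of_mem_erase (mem_sdiff.1 hi).1) (g3 h3 hm h)
      have h5 := (mem_sdiff.1 hi).2
      have h6 : ¬ ρ i < ρ m := fun h => h5 (h2.2 ⟨h3, h⟩)
      simp only [hi, if_true]; omega
    · refine (g3.mono fun i hi => hBs i hi).congr fun i hi => ?_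
      exact (if_pos hi).symm
  · rintro ⟨σ, τ⟩ h
    obtain ⟨hσ, hτ⟩ := mem_product.1 h
    refine Prod.ext (funext fun i => ?_) (funext fun i => ?_)
    · by_cases hi : i ∈ A
      · simp only [hi, if_true]; exact glueOutcome_left _ hA hi
      · simp only [hi, if_false]; exact ((mem_outcomes.1 hσ).2.1 i hi).symm
    · by_cases hi : i ∈ s.erase m \ A
      · simp only [hi, if_true]; exact glueOutcome_right _ hi
      · simp only [hi, if_false]; exact ((mem_outcomes.1 hτ).2.1 i hi).symm
  · intro ρ h
    obtain ⟨hρ, hρA⟩ := mem_filter.1 h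
    have hρm := apply_last_of_filter_eq hm hρ hρA
    funext i
    by_cases him : i = m
    · subst him
      rw [glueOutcome_last, hρm]
    by_cases hi : i ∈ A
    · simp [glueOutcome, him, hi]
    by_cases his : i ∈ s
    · simp [glueOutcome, him, hi, his]
    · simp [glueOutcome, his, him, hi, (mem_outcomes.1 hρ).2.1 i his]
  · rintro ⟨σ, τ⟩ h
    obtain ⟨hσ, hτ⟩ := mem_product.1 h
    rw [prod_eq_mul_split hm hA, carWeight_glueOutcome_last q c hm hmax hA hσ hτ,
      prod_congr rfl fun i hi => carWeight_glueOutcome_left q c hm hmax hA hσ hτ hi,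
      prod_congr rfl fun i hi => carWeight_glueOutcome_right q c hm hmax hA hσ hτ hi]

end Glue

theorem parkingSum_eq (q : ℕ → R) (c : R) (s : Finset ι) (b : ℕ) :
    parkingSum q c s b = forestParkingPoly q c #s := by
  induction hn : #s using Nat.strong_induction_on generalizing c s b with
  | _ n ih =>
  subst hn
  rcases s.eq_empty_or_nonempty with rfl | hs
  · have : outcomes (∅ : Finset ι) b = {fun _ => 0} := by
      ext σ; simp [mem_outcomes, funext_iff]
    simp [parkingSum, this, forestParkingPoly]
  · set m := s.max' hs with hmdef
    have hm : m ∈ s := max'_mem s hs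
    have hmax : ∀ i ∈ s, i ≤ m := fun i hi => le_max' s i hi
    have hcard := card_erase_add_one hm
    rw [← hcard, forestParkingPoly_succ, parkingSum,
      ← sum_fiberwise_of_maps_to (t := (s.erase m).powerset)
        (g := fun σ => ({i ∈ s | σ i < σ m} : Finset ι))]
    · refine sum_congr rfl fun A hA => ?_
      rw [mem_powerset] at hA
      have hle := card_le_card hA
      rw [parkingSum_fiber q c hm hmax hA, ih #A (by omega) 1 A _ rfl,
        ih #(s.erase m \ A) (by rw [card_sdiff_of_subset hA]; omega) c _ _ rfl,
        card_sdiff_of_subset hA]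
    · intro σ _
      rw [mem_powerset]
      intro i hi
      rw [mem_filter] at hi
      exact mem_erase.2 ⟨by rintro rfl; exact lt_irrefl _ hi.2, hi.1⟩

end Parking

section ParkingFunctions

variable {n : ℕ}

theorem PA_spec (p : Fin n → ℕ) (i : Fin n) :
    p i ≤ PA p i ∧ ∀ j : Fin n, j < i → PA p j ≠ PA p i := by
  have hne : {s : ℕ | p i ≤ s ∧ ∀ j : Fin n, j < i → PA p j ≠ s}.Nonempty := by
    obtain ⟨t, ht, h⟩ := (Set.Ici_infinite (p i)).exists_notMem_finset (univ.image (PA p))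
    exact ⟨t, ht, fun j _ hj => h (mem_image.2 ⟨j, mem_univ _, hj⟩)⟩
  have := Nat.sInf_mem hne
  rwa [← PA] at this

theorem exists_PA_eq (p : Fin n → ℕ) (i : Fin n) {u : ℕ} (h1 : p i ≤ u) (h2 : u < PA p i) :
    ∃ j < i, PA p j = u := by
  rw [PA] at h2
  have := Nat.notMem_of_lt_sInf h2
  simpa [h1] using this

theorem PA_injective (p : Fin n → ℕ) : Function.Injective (PA p) := by
  intro i j h
  rcases lt_trichotomy i j with hij | hij | hij
  · exact absurd h ((PA_spec p j).2 i hij)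
  · exact hij
  · exact absurd h.symm ((PA_spec p i).2 j hij)

theorem PA_eq_of_preferences {p σ : Fin n → ℕ} {b : ℕ} (hσ : Function.Injective σ)
    (h : ∀ i, p i ∈ preferences univ b σ i) : PA p = σ := by
  funext i
  induction i using WellFoundedLT.induction with
  | _ i ih =>
  have hi := h i
  simp only [preferences, mem_filter, mem_Ioc, mem_univ, true_and] at hi
  obtain ⟨⟨-, h2⟩, h3⟩ := hi
  apply le_antisymm
  · by_contra hlt
    obtain ⟨j, hj, hju⟩ := exists_PA_eq p i h2 (not_le.1 hlt)
    rw [ih j hj] at hju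
    exact hj.ne (hσ hju)
  · by_contra hlt
    obtain ⟨j, hj, hju⟩ := h3 _ (PA_spec p i).1 (not_le.1 hlt)
    exact (PA_spec p i).2 j hj ((ih j hj).trans hju)

theorem sum_parkingFunction_eq {R : Type*} [CommRing R] (q : ℕ → R) (c : R) :
    ∑ P : ParkingFunction n,
        (∏ i ∈ range (n + 1), q i ^ luckyCount P.1 i) * c ^ critic P.1 =
      parkingSum q c (univ : Finset (Fin n)) 0 := by
  classical
  simp only [parkingSum, carWeight, prod_mul_distrib, prod_univ_sum, sum_mul]
  rw [sum_sigma']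
  refine sum_bij' (fun P _ => ⟨PA P.1, P.1⟩)
    (fun x hx => ⟨x.2, ?_⟩) ?_ ?_ ?_ ?_ ?_
  · obtain ⟨h1, h2⟩ := mem_sigma.1 hx
    obtain ⟨a1, -, a3⟩ := mem_outcomes.1 h1
    rw [Fintype.mem_piFinset] at h2
    rw [IsParkingFunction, PA_eq_of_preferences (by simpa [Set.injOn_univ] using a3) h2]
    have a1' : ∀ i, x.1 i ≤ n := fun i => by simpa using (a1 i (mem_univ i)).2
    refine ⟨fun i => ?_, a1'⟩
    have := h2 i
    simp only [preferences, mem_filter, mem_Ioc] at this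
    exact ⟨this.1.1, this.1.2.trans (a1' i)⟩
  · rintro ⟨p, hp⟩ _
    refine mem_sigma.2 ⟨mem_outcomes.2 ⟨fun i _ => ⟨?_, ?_⟩, by simp, ?_⟩,
      Fintype.mem_piFinset.2 fun i => ?_⟩
    · exact lt_of_lt_of_le (hp.1 i).1 (PA_spec p i).1
    · simpa using hp.2 i
    · exact (PA_injective p).injOn
    · simp only [preferences, mem_filter, mem_Ioc, mem_univ, true_and]
      exact ⟨⟨(hp.1 i).1, (PA_spec p i).1⟩, fun u h1 h2 => exists_PA_eq p i h1 h2⟩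
  · intro x hx; exact mem_univ _
  · intro P _; rfl
  · rintro ⟨σ, p⟩ hx
    obtain ⟨h1, h2⟩ := mem_sigma.1 hx
    obtain ⟨a1, -, a3⟩ := mem_outcomes.1 h1
    have : PA p = σ :=
      PA_eq_of_preferences (by simpa [Set.injOn_univ] using a3) (Fintype.mem_piFinset.1 h2)
    simp [this]
  · rintro ⟨p, hp⟩ _
    simp only [luckyCount, critic]
    rw [prod_range_pow_ncard q (jumpAt p) (n + 1), pow_ncard_eq_prod_ite]
    · simp only [jumpAt, IsCritical, OutcomeCritical, mem_univ, true_and, card_univ,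
        Fintype.card_fin, zero_add]
      congr
    · intro i
      have := hp.2 i
      unfold jumpAt
      omega

end ParkingFunctions

theorem sum_card_filter_lt {ι R : Type*} [LinearOrder ι] [AddCommMonoid R] (q : ℕ → R)
    (A : Finset ι) : ∑ r ∈ A, q #{x ∈ A | x < r} = ∑ j ∈ range #A, q j := by
  induction A using Finset.induction_on_max with
  | empty => simp
  | insert a A ha ih =>
    have haA : a ∉ A := fun h => lt_irrefl _ (ha a h)
    rw [sum_insert haA, card_insert_of_notMem haA, sum_range_succ, ← ih, add_comm]
    congr 1
    · refine sum_congr rfl fun r hr => ?_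
      rw [filter_insert, if_neg (ha r hr).not_gt]
    · rw [filter_insert, if_neg (lt_irrefl a), filter_true_of_mem ha]

section ParentFunctions

variable {ι : Type*}

/-- `x` is a descendant of `v` for the parent function `par`. -/
def IsDescendant (par : ι → Option ι) (v x : ι) : Prop :=
  Relation.ReflTransGen (fun a b => par a = some b) x v

/-- `par` is the parent function of a rooted forest on the vertex set `s`; acyclicity is
expressed by a height function. -/
def IsForestOn (s : Finset ι) (par : ι → Option ι) : Prop :=
  (∀ v u, par v = some u → v ∈ s ∧ u ∈ s) ∧ ∃ h : ι → ℕ, ∀ v u, par v = some u → h u < h v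

theorem IsDescendant.of_closed {par par' : ι → Option ι} {D : Set ι}
    (hD : ∀ x y, y ∈ D → par x = some y → x ∈ D ∧ par' x = some y) {v x : ι} (hv : v ∈ D)
    (h : IsDescendant par v x) : x ∈ D ∧ IsDescendant par' v x := by
  induction h using Relation.ReflTransGen.head_induction_on with
  | refl => exact ⟨hv, .refl⟩
  | head hxy _ ih =>
    obtain ⟨h1, h2⟩ := hD _ _ ih.1 hxy
    exact ⟨h1, .head h2 ih.2⟩

theorem isDescendant_iff_of_closed {par par' : ι → Option ι} {D : Set ι}
    (hD : ∀ x y, y ∈ D → (par x = some y ↔ par' x = some y))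
    (hD' : ∀ x y, y ∈ D → par x = some y → x ∈ D) {v : ι} (hv : v ∈ D) (x : ι) :
    IsDescendant par v x ↔ IsDescendant par' v x :=
  ⟨fun h => (h.of_closed (fun x y hy hxy => ⟨hD' x y hy hxy, (hD x y hy).1 hxy⟩) hv).2,
    fun h => (h.of_closed (fun x y hy hxy =>
      ⟨hD' x y hy ((hD x y hy).2 hxy), (hD x y hy).2 hxy⟩) hv).2⟩

theorem IsDescendant.eq_of_root {par : ι → Option ι} {r v : ι} (hr : par r = none)
    (h : IsDescendant par v r) : v = r := by
  rcases Relation.ReflTransGen.cases_head h with h | ⟨w, hw, -⟩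
  · exact h.symm
  · rw [hr] at hw; cases hw

theorem exists_parent_of_isDescendant {par : ι → Option ι} {r v : ι} (hvr : v ≠ r) (h : IsDescendant par r v) :
    ∃ u, par v = some u ∧ IsDescendant par r u := by
  rcases Relation.ReflTransGen.cases_head h with h | h
  · exact absurd h hvr
  · exact h

theorem IsDescendant.root_unique {par : ι → Option ι} {a r r' : ι} (hr : par r = none)
    (hr' : par r' = none) (h : IsDescendant par r a) (h' : IsDescendant par r' a) : r = r' := by
  rcases Relation.ReflTransGen.total_of_right_unique
    (fun x y z hy hz => Option.some.inj (hy.symm.trans hz)) h h' with h | h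
  · exact (IsDescendant.eq_of_root hr h).symm
  · exact IsDescendant.eq_of_root hr' h

theorem IsForestOn.mem_of_isDescendant {s : Finset ι} {par : ι → Option ι}
    (h : IsForestOn s par) {v x : ι} (hv : v ∈ s) (hx : IsDescendant par v x) : x ∈ s :=
  (hx.of_closed (par' := par) (D := s) (fun x y _ hxy => ⟨(h.1 x y hxy).1, hxy⟩) hv).1

theorem IsForestOn.ancestor_mem {s : Finset ι} {par : ι → Option ι}
    (h : IsForestOn s par) {v x : ι} (hx : x ∈ s) (hv : IsDescendant par v x) : v ∈ s := by
  rcases Relation.ReflTransGen.cases_tail hv with rfl | ⟨w, -, hw⟩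
  · exact hx
  · exact (h.1 w v hw).2

theorem IsForestOn.exists_root {s : Finset ι} {par : ι → Option ι}
    (h : IsForestOn s par) (x : ι) : ∃ r, par r = none ∧ IsDescendant par r x := by
  obtain ⟨-, f, hf⟩ := h
  induction hn : f x using Nat.strong_induction_on generalizing x with
  | _ n ih =>
  cases hx : par x with
  | none => exact ⟨x, hx, .refl⟩
  | some u =>
    obtain ⟨r, hr, hru⟩ := ih (f u) (hn ▸ hf x u hx) u rfl
    exact ⟨r, hr, .head hx hru⟩

variable [DecidableEq ι]

/-- Join a tree with root `r` and vertex set `A`, given by the forest `par₁` left when its root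
is deleted, to a forest `par₂` on other vertices. -/
def glueForest (A : Finset ι) (r : ι) (par₁ par₂ : ι → Option ι) (v : ι) : Option ι :=
  if v = r then none else if v ∈ A then (par₁ v).or (some r) else par₂ v

/-- Delete from a forest everything except the tree `A`, and the root `r` of that tree. -/
def restrictTree (A : Finset ι) (r : ι) (par : ι → Option ι) (v : ι) : Option ι :=
  if v ∈ A.erase r then (if par v = some r then none else par v) else none

/-- Delete the tree `A` from a forest. -/
def deleteTree (A : Finset ι) (par : ι → Option ι) (v : ι) : Option ι :=
  if v ∈ A then none else par v

variable {s A : Finset ι} {r : ι} {par par₁ par₂ : ι → Option ι}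

theorem glueForest_root : glueForest A r par₁ par₂ r = none := by simp [glueForest]

theorem glueForest_eq_some (hr : r ∈ A) (h₂ : IsForestOn (s \ A) par₂) {v u : ι} :
    glueForest A r par₁ par₂ v = some u ↔
      (v ∈ A.erase r ∧ (par₁ v = some u ∨ par₁ v = none ∧ r = u)) ∨ par₂ v = some u := by
  have hA : v ∈ A → par₂ v ≠ some u := fun hv h => (mem_sdiff.1 (h₂.1 v u h).1).2 hv
  unfold glueForest
  by_cases hvr : v = r
  · subst hvr
    simpa using hA hr
  · by_cases hv : v ∈ A
    · cases par₁ v <;> simp [hvr, hv, hA hv]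
    · simp [hvr, hv]

theorem IsForestOn.glueForest (hr : r ∈ A) (hA : A ⊆ s) (h₁ : IsForestOn (A.erase r) par₁)
    (h₂ : IsForestOn (s \ A) par₂) : IsForestOn s (glueForest A r par₁ par₂) := by
  obtain ⟨f₁, hf₁⟩ := h₁.2
  obtain ⟨f₂, hf₂⟩ := h₂.2
  refine ⟨fun v u h => ?_,
    fun v => if v ∈ A then (if v = r then 0 else f₁ v + 1) else f₂ v, fun v u h => ?_⟩
  · rcases (glueForest_eq_some hr h₂).1 h with ⟨hv, h | ⟨-, rfl⟩⟩ | h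
    · exact ⟨hA (mem_of_mem_erase hv), hA (mem_of_mem_erase (h₁.1 v u h).2)⟩
    · exact ⟨hA (mem_of_mem_erase hv), hA hr⟩
    · exact ⟨(mem_sdiff.1 (h₂.1 v u h).1).1, (mem_sdiff.1 (h₂.1 v u h).2).1⟩
  · rcases (glueForest_eq_some hr h₂).1 h with ⟨hv, h | ⟨-, rfl⟩⟩ | h
    · have hu := (h₁.1 v u h).2
      rw [mem_erase] at hu hv
      simpa [hu, hv] using hf₁ v u h
    · rw [mem_erase] at hv
      simp [hv, hr]
    · have hvu := h₂.1 v u h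
      rw [mem_sdiff, mem_sdiff] at hvu
      simpa [hvu] using hf₂ v u h

theorem isDescendant_glueForest_root (hr : r ∈ A) (h₁ : IsForestOn (A.erase r) par₁)
    (h₂ : IsForestOn (s \ A) par₂) (x : ι) :
    IsDescendant (glueForest A r par₁ par₂) r x ↔ x ∈ A := by
  constructor
  · intro h
    refine (h.of_closed (par' := _root_.glueForest A r par₁ par₂) (D := A)
      (fun x y hy hxy => ⟨?_, hxy⟩) hr).1
    rcases (glueForest_eq_some hr h₂).1 hxy with ⟨hv, -⟩ | h
    · exact mem_of_mem_erase hv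
    · exact absurd hy (mem_sdiff.1 (h₂.1 x y h).2).2
  · intro hx
    obtain ⟨f, hf⟩ := h₁.2
    induction hn : f x using Nat.strong_induction_on generalizing x with
    | _ n ih =>
    by_cases hxr : x = r
    · subst hxr; exact .refl
    have hx' : x ∈ A.erase r := mem_erase.2 ⟨hxr, hx⟩
    cases hpx : par₁ x with
    | none => exact .single ((glueForest_eq_some hr h₂).2 (.inl ⟨hx', .inr ⟨hpx, rfl⟩⟩))
    | some u =>
      exact .head ((glueForest_eq_some hr h₂).2 (.inl ⟨hx', .inl hpx⟩))
        (ih (f u) (hn ▸ hf x u hpx) u (mem_of_mem_erase (h₁.1 x u hpx).2) rfl)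

theorem isDescendant_glueForest_tree (hr : r ∈ A) (h₁ : IsForestOn (A.erase r) par₁)
    (h₂ : IsForestOn (s \ A) par₂) {v : ι} (hv : v ∈ A.erase r) (x : ι) :
    IsDescendant (glueForest A r par₁ par₂) v x ↔ IsDescendant par₁ v x := by
  have key : ∀ x y, y ∈ A.erase r → (glueForest A r par₁ par₂ x = some y ↔ par₁ x = some y) := by
    intro x y hy
    rw [glueForest_eq_some hr h₂]
    constructor
    · rintro (⟨-, h | ⟨-, rfl⟩⟩ | h)
      · exact h
      · simp at hy
      · exact absurd (mem_of_mem_erase hy) (mem_sdiff.1 (h₂.1 x y h).2).2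
    · exact fun h => .inl ⟨(h₁.1 x y h).1, .inl h⟩
  exact isDescendant_iff_of_closed (D := A.erase r) key
    (fun x y hy h => (h₁.1 x y ((key x y hy).1 h)).1) hv x

theorem isDescendant_glueForest_compl (hr : r ∈ A) (h₁ : IsForestOn (A.erase r) par₁)
    (h₂ : IsForestOn (s \ A) par₂) {v : ι} (hv : v ∈ s \ A) (x : ι) :
    IsDescendant (glueForest A r par₁ par₂) v x ↔ IsDescendant par₂ v x := by
  have key : ∀ x y, y ∈ s \ A → (glueForest A r par₁ par₂ x = some y ↔ par₂ x = some y) := by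
    intro x y hy
    rw [mem_sdiff] at hy
    rw [glueForest_eq_some hr h₂]
    constructor
    · rintro (⟨-, h | ⟨-, rfl⟩⟩ | h)
      · exact absurd (mem_of_mem_erase (h₁.1 x y h).2) hy.2
      · exact absurd hr hy.2
      · exact h
    · exact .inr
  exact isDescendant_iff_of_closed (D := (s \ A : Finset ι)) key
    (fun x y hy h => (h₂.1 x y ((key x y hy).1 h)).1) hv x

theorem IsForestOn.restrictTree (h : IsForestOn s par)
    (hdesc : ∀ x, IsDescendant par r x ↔ x ∈ A) :
    IsForestOn (A.erase r) (restrictTree A r par) := by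
  have key : ∀ v u, _root_.restrictTree A r par v = some u →
      v ∈ A.erase r ∧ par v = some u ∧ u ≠ r := by
    intro v u h
    unfold _root_.restrictTree at h
    split_ifs at h with h1 h2
    exact ⟨h1, h, by rintro rfl; exact h2 h⟩
  obtain ⟨f, hf⟩ := h.2
  refine ⟨fun v u hvu => ?_, f, fun v u hvu => hf v u (key v u hvu).2.1⟩
  obtain ⟨h1, h2, h3⟩ := key v u hvu
  refine ⟨h1, mem_erase.2 ⟨h3, ?_⟩⟩
  rw [mem_erase] at h1
  obtain ⟨w, hw, hwr⟩ := exists_parent_of_isDescendant h1.1 ((hdesc v).2 h1.2)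
  rw [h2] at hw
  cases hw
  exact (hdesc u).1 hwr

theorem IsForestOn.deleteTree (h : IsForestOn s par)
    (hdesc : ∀ x, IsDescendant par r x ↔ x ∈ A) :
    IsForestOn (s \ A) (deleteTree A par) := by
  have key : ∀ v u, _root_.deleteTree A par v = some u → v ∉ A ∧ par v = some u := by
    intro v u h
    unfold _root_.deleteTree at h
    split_ifs at h with h1
    exact ⟨h1, h⟩
  obtain ⟨f, hf⟩ := h.2
  refine ⟨fun v u hvu => ?_, f, fun v u hvu => hf v u (key v u hvu).2⟩
  obtain ⟨h1, h2⟩ := key v u hvu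
  refine ⟨mem_sdiff.2 ⟨(h.1 v u h2).1, h1⟩, mem_sdiff.2 ⟨(h.1 v u h2).2, fun hu => h1 ?_⟩⟩
  exact (hdesc v).1 (.head h2 ((hdesc u).2 hu))

theorem restrictTree_glueForest (h₁ : IsForestOn (A.erase r) par₁) :
    restrictTree A r (glueForest A r par₁ par₂) = par₁ := by
  funext v
  unfold restrictTree
  split_ifs with hv h
  · cases hp : par₁ v with
    | none => rfl
    | some u =>
      have hu := (h₁.1 v u hp).2
      rw [mem_erase] at hu hv
      simp only [glueForest, hv.1, hv.2, hp, if_true, if_false, Option.some_or,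
        Option.some.injEq] at h
      exact absurd h hu.1
  · rw [mem_erase] at hv
    simp only [glueForest, hv.1, hv.2, if_true, if_false] at h ⊢
    cases hp : par₁ v with
    | none => simp [hp] at h
    | some u => rfl
  · cases hp : par₁ v with
    | none => rfl
    | some u => exact absurd (h₁.1 v u hp).1 hv

theorem deleteTree_glueForest (hr : r ∈ A) (h₂ : IsForestOn (s \ A) par₂) :
    deleteTree A (glueForest A r par₁ par₂) = par₂ := by
  funext v
  unfold deleteTree
  split_ifs with hv
  · cases hp : par₂ v with
    | none => rfl
    | some u => exact absurd hv (mem_sdiff.1 (h₂.1 v u hp).1).2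
  · have hvr : v ≠ r := by rintro rfl; exact hv hr
    simp [glueForest, hv, hvr]

theorem glueForest_restrict (hroot : par r = none) (hdesc : ∀ x, IsDescendant par r x ↔ x ∈ A) :
    glueForest A r (restrictTree A r par) (deleteTree A par) = par := by
  funext v
  unfold glueForest
  split_ifs with hvr hv
  · rw [hvr, hroot]
  · obtain ⟨u, hu, -⟩ := exists_parent_of_isDescendant hvr ((hdesc v).2 hv)
    by_cases hur : u = r
    · simp [restrictTree, hu, hur]
    · simp [restrictTree, hu, hur, hvr, hv]
  · simp [deleteTree, hv]

end ParentFunctions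

section Trees

variable {ι : Type*} [Fintype ι]

open Classical in
/-- The root of the tree containing `a`. -/
noncomputable def treeRoot (a : ι) (par : ι → Option ι) : ι :=
  if h : ∃ r, par r = none ∧ IsDescendant par r a then h.choose else a

open Classical in
/-- The descendants of `r`. -/
noncomputable def descendants (par : ι → Option ι) (r : ι) : Finset ι := {x | IsDescendant par r x}

theorem mem_descendants {par : ι → Option ι} {r x : ι} :
    x ∈ descendants par r ↔ IsDescendant par r x := by simp [descendants]

theorem IsForestOn.treeRoot_spec {s : Finset ι} {par : ι → Option ι} (h : IsForestOn s par)
    (a : ι) : par (treeRoot a par) = none ∧ IsDescendant par (treeRoot a par) a := by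
  have := h.exists_root a
  rw [treeRoot, dif_pos this]
  exact this.choose_spec

theorem IsForestOn.treeRoot_eq_iff {s : Finset ι} {par : ι → Option ι} (h : IsForestOn s par)
    {a r : ι} {A : Finset ι} (ha : a ∈ A) :
    (descendants par (treeRoot a par) = A ∧ treeRoot a par = r) ↔
      par r = none ∧ ∀ x, IsDescendant par r x ↔ x ∈ A := by
  obtain ⟨h1, h2⟩ := h.treeRoot_spec a
  constructor
  · rintro ⟨rfl, rfl⟩
    exact ⟨h1, fun x => mem_descendants.symm⟩
  · rintro ⟨h3, h4⟩
    have : treeRoot a par = r := IsDescendant.root_unique h1 h3 h2 ((h4 a).2 ha)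
    subst this
    exact ⟨by ext x; rw [mem_descendants, h4], rfl⟩

end Trees

section ForestSum

variable {ι : Type*} [Fintype ι] [LinearOrder ι]

open Classical in
/-- The number of inversions at `v`. -/
noncomputable def inversionsAt (par : ι → Option ι) (v : ι) : ℕ :=
  #{x | x < v ∧ IsDescendant par v x}

variable {R : Type*} [CommRing R]

/-- The factor contributed by the vertex `v`. -/
noncomputable def vertexWeight (q : ℕ → R) (c : R) (par : ι → Option ι) (v : ι) : R :=
  q (inversionsAt par v) * if par v = none then c else 1

open Classical in
/-- The generating function of the rooted forests on `s`. -/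
noncomputable def forestSum (q : ℕ → R) (c : R) (s : Finset ι) : R :=
  ∑ par : ι → Option ι with IsForestOn s par, ∏ v ∈ s, vertexWeight q c par v

open Classical in
theorem forestSum_fiber (q : ℕ → R) (c : R) {s A : Finset ι} {r : ι} (hr : r ∈ A) (hA : A ⊆ s) :
    ∑ par : ι → Option ι with IsForestOn s par ∧ par r = none ∧ ∀ x, IsDescendant par r x ↔ x ∈ A,
        ∏ v ∈ s, vertexWeight q c par v =
      c * q #{x ∈ A | x < r} * forestSum q 1 (A.erase r) * forestSum q c (s \ A) := by
  rw [mul_assoc, forestSum, forestSum, sum_mul_sum, ← sum_product', mul_sum]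
  symm
  refine sum_bij' (fun x _ => glueForest A r x.1 x.2)
    (fun par _ => (restrictTree A r par, deleteTree A par)) ?_ ?_ ?_ ?_ ?_
  · rintro ⟨par₁, par₂⟩ h
    simp only [mem_product, mem_filter, mem_univ, true_and] at h ⊢
    exact ⟨h.1.glueForest hr hA h.2, glueForest_root, isDescendant_glueForest_root hr h.1 h.2⟩
  · intro par h
    simp only [mem_product, mem_filter, mem_univ, true_and] at h ⊢
    exact ⟨h.1.restrictTree h.2.2, h.1.deleteTree h.2.2⟩
  · rintro ⟨par₁, par₂⟩ h
    simp only [mem_product, mem_filter, mem_univ, true_and] at h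
    exact Prod.ext (restrictTree_glueForest h.1) (deleteTree_glueForest hr h.2)
  · intro par h
    simp only [mem_filter, mem_univ, true_and] at h
    exact glueForest_restrict h.2.1 h.2.2
  · rintro ⟨par₁, par₂⟩ h
    simp only [mem_product, mem_filter, mem_univ, true_and] at h
    obtain ⟨h₁, h₂⟩ := h
    have hroot : vertexWeight q c (glueForest A r par₁ par₂) r = c * q #{x ∈ A | x < r} := by
      rw [vertexWeight, if_pos glueForest_root, mul_comm, inversionsAt]
      congr 3
      ext x
      simp [isDescendant_glueForest_root hr h₁ h₂, and_comm]
    have htree : ∀ v ∈ A.erase r,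
        vertexWeight q c (glueForest A r par₁ par₂) v = vertexWeight q 1 par₁ v := by
      intro v hv
      have hne : glueForest A r par₁ par₂ v ≠ none := by
        rw [mem_erase] at hv
        simp [glueForest, hv]
      simp only [vertexWeight, inversionsAt, isDescendant_glueForest_tree hr h₁ h₂ hv, hne,
        if_false, ite_self]
    have hcompl : ∀ v ∈ s \ A,
        vertexWeight q c (glueForest A r par₁ par₂) v = vertexWeight q c par₂ v := by
      intro v hv
      have heq : glueForest A r par₁ par₂ v = par₂ v := by
        have hvA := (mem_sdiff.1 hv).2
        have hvr : v ≠ r := by rintro rfl; exact hvA hr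
        simp [glueForest, hvA, hvr]
      simp only [vertexWeight, inversionsAt, isDescendant_glueForest_compl hr h₁ h₂ hv, heq]
    rw [← prod_sdiff hA, ← mul_prod_erase A _ hr, hroot, prod_congr rfl htree,
      prod_congr rfl hcompl]
    ring

theorem forestSum_eq_sum_powerset (q : ℕ → R) (c : R) {s : Finset ι} {a : ι} (ha : a ∈ s) :
    forestSum q c s = ∑ A ∈ (s.erase a).powerset, ∑ r ∈ insert a A,
      c * q #{x ∈ insert a A | x < r} * forestSum q 1 ((insert a A).erase r) *
        forestSum q c (s \ insert a A) := by
  classical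
  rw [sum_sigma', forestSum, ← sum_fiberwise_of_maps_to
    (t := (s.erase a).powerset.sigma fun A => insert a A)
    (g := fun par => ⟨(descendants par (treeRoot a par)).erase a, treeRoot a par⟩)]
  · refine sum_congr rfl ?_
    rintro ⟨A, r⟩ hx
    simp only [mem_sigma, mem_powerset] at hx
    obtain ⟨hA, hr⟩ := hx
    have haA : a ∉ A := fun h => notMem_erase a s (hA h)
    rw [← forestSum_fiber q c hr (insert_subset ha (hA.trans (erase_subset a s))),
      filter_filter]
    refine sum_congr (filter_congr fun par _ => and_congr_right fun hp => ?_) fun _ _ => rfl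
    rw [← hp.treeRoot_eq_iff (mem_insert_self a A), Sigma.mk.injEq, heq_eq_eq]
    refine and_congr_left fun _ => ?_
    have hmem := mem_descendants.2 (hp.treeRoot_spec a).2
    constructor
    · intro h; rw [← h, insert_erase hmem]
    · intro h; rw [h, erase_insert haA]
  · intro par hp
    simp only [mem_filter, mem_univ, true_and] at hp
    obtain ⟨h1, h2⟩ := hp.treeRoot_spec a
    have hmem := mem_descendants.2 h2
    simp only [mem_sigma, mem_powerset, insert_erase hmem]
    exact ⟨erase_subset_erase a fun x hx => hp.mem_of_isDescendant (hp.ancestor_mem ha h2)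
      (mem_descendants.1 hx), mem_descendants.2 .refl⟩

theorem forestSum_eq (q : ℕ → R) (c : R) (s : Finset ι) :
    forestSum q c s = forestParkingPoly q c #s := by
  induction hn : #s using Nat.strong_induction_on generalizing c s with
  | _ n ih =>
  subst hn
  rcases s.eq_empty_or_nonempty with rfl | ⟨a, ha⟩
  · classical
    have : ({par : ι → Option ι | IsForestOn ∅ par} : Finset _) = {fun _ => none} := by
      ext par
      simp only [IsForestOn, mem_filter, mem_univ, true_and, mem_singleton, notMem_empty,
        and_false, imp_false]
      constructor
      · rintro ⟨h, -⟩
        funext v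
        exact Option.eq_none_iff_forall_ne_some.2 (h v)
      · rintro rfl; simp
    simp [forestSum, this, forestParkingPoly]
  · have hcard := card_erase_add_one ha
    rw [← hcard, forestParkingPoly_succ, forestSum_eq_sum_powerset q c ha]
    refine sum_congr rfl fun A hA => ?_
    rw [mem_powerset] at hA
    have haA : a ∉ A := fun h => notMem_erase a s (hA h)
    have hle := card_le_card hA
    have hins := card_insert_of_notMem haA
    have hsd : #(s \ insert a A) = #(s.erase a) - #A := by
      rw [card_sdiff_of_subset (insert_subset ha (hA.trans (erase_subset a s)))]
      omega
    rw [ih #(s \ insert a A) (by omega) c _ rfl, hsd, ← hins, ← sum_card_filter_lt, mul_sum,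
      sum_mul, sum_mul]
    refine sum_congr rfl fun r hr => ?_
    have her : #((insert a A).erase r) = #A := by rw [card_erase_of_mem hr, hins]; rfl
    rw [ih #((insert a A).erase r) (by omega) 1 _ rfl, her]

end ForestSum

section Forests

variable {n : ℕ}

theorem isForest_iff (par : Fin n → Option (Fin n)) : IsForest par ↔ IsForestOn univ par := by
  classical
  constructor
  · intro h
    refine ⟨by simp, fun v => #{u | Relation.TransGen (fun a b => par a = some b) v u},
      fun v u hvu => card_lt_card ?_⟩
    rw [ssubset_iff_of_subset]
    · exact ⟨u, by simpa using .single hvu, by simpa using h u⟩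
    · intro w hw
      simp only [mem_filter, mem_univ, true_and] at hw ⊢
      exact .head hvu hw
  · rintro ⟨-, f, hf⟩ v hv
    have : ∀ u, Relation.TransGen (fun a b => par a = some b) v u → f u < f v := by
      intro u hu
      induction hu with
      | single h => exact hf _ _ h
      | tail _ h ih => exact (hf _ _ h).trans ih
    exact lt_irrefl _ (this v hv)

theorem sum_forest_eq {R : Type*} [CommRing R] (q : ℕ → R) (c : R) :
    ∑ F : Forest n, (∏ i ∈ range (n + 1), q i ^ forestLeadCount F i) * c ^ forestTree F =
      forestSum q c (univ : Finset (Fin n)) := by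
  classical
  rw [forestSum]
  refine sum_bij' (fun F _ => F.1)
    (fun par hp => ⟨par, (isForest_iff par).2 (mem_filter.1 hp).2⟩) ?_ ?_ ?_ ?_ ?_
  · rintro ⟨par, hp⟩ _
    exact mem_filter.2 ⟨mem_univ _, (isForest_iff par).1 hp⟩
  · intro x hx; exact mem_univ _
  · intro F _; rfl
  · intro par _; rfl
  · rintro ⟨par, hp⟩ _
    have hinv : ∀ v, forestInvAt ⟨par, hp⟩ v = inversionsAt par v := fun v => by
      unfold forestInvAt inversionsAt
      rw [← Set.ncard_coe_finset]
      congr 1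
      ext x
      simp only [coe_filter, mem_univ, true_and]
      rfl
    simp only [forestLeadCount, forestTree, hinv]
    rw [prod_range_pow_ncard q (inversionsAt par) (n + 1), pow_ncard_eq_prod_ite,
      ← prod_mul_distrib]
    · refine prod_congr rfl fun v _ => ?_
      rw [vertexWeight]
      congr
    · intro v
      exact Nat.lt_succ_of_le ((card_le_univ _).trans (by simp))

end Forests

/-- `I_n(q; c) = J_n(q; c)` for all `q_0, ..., q_n, c` in a commutative
ring. -/
theorem In_eq_Jn (n : ℕ) (hn : 1 ≤ n) (R : Type*) [CommRing R] (q : ℕ → R) (c : R) :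
    ∑ F : Forest n,
        (∏ i ∈ Finset.range (n + 1), q i ^ forestLeadCount F i) * c ^ forestTree F
      = ∑ P : ParkingFunction n,
          (∏ i ∈ Finset.range (n + 1), q i ^ luckyCount P.1 i) * c ^ critic P.1 := by
  rw [sum_forest_eq, sum_parkingFunction_eq, forestSum_eq, parkingSum_eq]
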